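/- Assume q^e ≥ 4d². Then there exists an element α ∈ 𝔽_{q^e} such that y(α) generates 𝔽_{q^e} over 𝔽_q (i.e. the subfield 𝔽_q(y(α)) equals 𝔽_{q^e}); in particular α itself also generates 𝔽_{q^e} over 𝔽_q. -/

import Mathlib

open Polynomial

theorem aux_nongen (q e : ℕ) (Fq Fe : Type) [Field Fq] [Fintype Fq] [Field Fe] [Fintype Fe]
    [Algebra Fq Fe] (hq : Fintype.card Fq = q) (hFe : Fintype.card Fe = q ^ e)
    (x : Fe) (hx : Algebra.adjoin Fq {x} ≠ ⊤) :
    ∃ f ∈ Finset.Icc 1 (e / 2), x ^ (q ^ f) = x := by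
  have hq1 : 1 < q := hq ▸ Fintype.one_lt_card
  have hfr : Module.finrank Fq Fe = e := by
    have h := Module.card_eq_pow_finrank (K := Fq) (V := Fe)
    rw [hFe, hq] at h
    exact (Nat.pow_right_injective hq1 h).symm
  let E := IntermediateField.adjoin Fq {x}
  have hmul : Module.finrank Fq E * Module.finrank E Fe = e := by
    rw [← hfr]; exact Module.finrank_mul_finrank Fq E Fe
  have hpos : 0 < Module.finrank Fq E := Module.finrank_pos
  have hpos2 : 0 < Module.finrank E Fe := Module.finrank_pos
  have hne : Module.finrank E Fe ≠ 1 := by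
    intro h
    apply hx
    have hE : E = ⊤ := IntermediateField.finrank_eq_one_iff_eq_top.mp h
    have h2 : E.toSubalgebra = Algebra.adjoin Fq {x} :=
      IntermediateField.adjoin_simple_toSubalgebra_of_isAlgebraic
        (Algebra.IsAlgebraic.isAlgebraic x)
    rw [← h2, hE]; rfl
  refine ⟨Module.finrank Fq E, Finset.mem_Icc.mpr ⟨hpos, ?_⟩, ?_⟩
  · rw [Nat.le_div_iff_mul_le (by norm_num)]
    calc _ ≤ Module.finrank Fq E * Module.finrank E Fe := Nat.mul_le_mul_left _ (by omega)
      _ = e := hmul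
  · haveI : Fintype E := Fintype.ofFinite E
    have hc := Module.card_eq_pow_finrank (K := Fq) (V := E)
    rw [hq] at hc
    have h := FiniteField.pow_card (⟨x, IntermediateField.mem_adjoin_simple_self Fq x⟩ : E)
    rw [hc] at h
    exact congrArg Subtype.val h

theorem aux_roots (Fe : Type) [Field Fe] [Fintype Fe] [DecidableEq Fe] (n : ℕ) (hn : 1 < n) :
    (Finset.univ.filter (fun x : Fe => x ^ n = x)).card ≤ n := by
  have hne : (X ^ n - X : Fe[X]) ≠ 0 := FiniteField.X_pow_card_sub_X_ne_zero Fe hn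
  calc _ ≤ (X ^ n - X : Fe[X]).roots.toFinset.card := by
        apply Finset.card_le_card
        intro x hx
        simp only [Finset.mem_filter, Finset.mem_univ, true_and] at hx
        simp [Polynomial.mem_roots hne, hx]
    _ ≤ _ := (Multiset.toFinset_card_le _)
    _ ≤ (X ^ n - X : Fe[X]).natDegree := Polynomial.card_roots' _
    _ = n := FiniteField.X_pow_card_sub_X_natDegree_eq Fe hn

theorem aux_sum (q m : ℕ) (hq : 2 ≤ q) : ∑ f ∈ Finset.Icc 1 m, q ^ f + 2 ≤ 2 * q ^ m := by
  induction m with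
  | zero => simp
  | succ k ih =>
    rw [Finset.sum_Icc_succ_top (by omega), pow_succ]
    have := Nat.mul_le_mul_left (q ^ k) hq
    omega

theorem aux_deg (d : ℕ) (Fq K : Type) [Field Fq] [Field K] [Algebra Fq K] (hd : 2 ≤ d)
    (φ : K ≃ₐ[Fq] K) (β : K) (hβ : β ≠ 0) (Y : Polynomial Fq)
    (hY : Y.map (algebraMap Fq K) = (∏ i ∈ Finset.range d, (1 + C ((φ ^ i) β) * X)) - 1) :
    Y.natDegree = d := by
  rw [← Polynomial.natDegree_map (algebraMap Fq K), hY, ← C_1, natDegree_sub_C]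
  have h1 : ∀ i, (C 1 + C ((φ ^ i) β) * X : K[X]).natDegree = 1 := by
    intro i
    rw [add_comm]
    exact natDegree_linear ((map_ne_zero_iff _ (φ ^ i).injective).mpr hβ)
  rw [natDegree_prod]
  · simp only [h1]; simp
  · intro i _ h
    have := h1 i
    rw [h] at this
    simp at this



/-- if `q^e ≥ 4d²`, there exists `α ∈ 𝔽_{q^e}` such that `y(α)` generates
`𝔽_{q^e}` over `𝔽_q`; in particular `α` itself also generates `𝔽_{q^e}` over `𝔽_q`. -/
theorem stmt6 (q d e : ℕ) (Fq K Fe : Type) [Field Fq] [Fintype Fq] [Field K] [Fintype K]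
    [Algebra Fq K] [Field Fe] [Fintype Fe] [Algebra Fq Fe]
    (hq : Fintype.card Fq = q) (hd : 2 ≤ d) (hK : Fintype.card K = q ^ d)
    (φ : K ≃ₐ[Fq] K) (hφ : ∀ σ : K ≃ₐ[Fq] K, σ ∈ Subgroup.zpowers φ)
    (β : K) (hβ : Algebra.trace Fq K β ≠ 0)
    (Y : Polynomial Fq)
    (hY : Y.map (algebraMap Fq K) = (∏ i ∈ Finset.range d, (1 + C ((φ ^ i) β) * X)) - 1)
    (he : 1 ≤ e) (hFe : Fintype.card Fe = q ^ e)
    (hbig : 4 * d ^ 2 ≤ q ^ e) :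
    ∃ α : Fe, Algebra.adjoin Fq {(aeval α Y : Fe)} = ⊤ ∧ Algebra.adjoin Fq {α} = ⊤ := by
  classical
  have hq1 : 1 < q := hq ▸ Fintype.one_lt_card
  have hβ0 : β ≠ 0 := by rintro rfl; simp at hβ
  have hdeg := aux_deg d Fq K hd φ β hβ0 Y hY
  suffices h : ∃ α : Fe, Algebra.adjoin Fq {(aeval α Y : Fe)} = ⊤ by
    obtain ⟨α, hα⟩ := h
    refine ⟨α, hα, ?_⟩
    rw [eq_top_iff, ← hα]
    apply Algebra.adjoin_le
    rw [Set.singleton_subset_iff]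
    exact Polynomial.aeval_mem_adjoin_singleton Fq α
  by_contra! hno
  let S : Finset Fe := (Finset.Icc 1 (e / 2)).biUnion
    (fun f => Finset.univ.filter (fun x : Fe => x ^ (q ^ f) = x))
  have hS : S.card ≤ ∑ f ∈ Finset.Icc 1 (e / 2), q ^ f := by
    refine Finset.card_biUnion_le.trans (Finset.sum_le_sum ?_)
    intro f hf
    have := (Finset.mem_Icc.mp hf).1
    exact aux_roots Fe _ (Nat.one_lt_pow (by omega) hq1)
  have hfib : (Finset.univ : Finset Fe).card ≤ d * S.card := by
    apply Finset.card_le_mul_card_image_of_maps_to (f := fun α : Fe => (aeval α Y : Fe))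
    · intro α _
      obtain ⟨f, hf, hx⟩ := aux_nongen q e Fq Fe hq hFe _ (hno α)
      exact Finset.mem_biUnion.mpr ⟨f, hf, by simpa using hx⟩
    · intro b _
      have hdZ : (Y.map (algebraMap Fq Fe) - C b).natDegree = d := by
        rw [natDegree_sub_C, natDegree_map, hdeg]
      have hne : Y.map (algebraMap Fq Fe) - C b ≠ 0 := by
        intro h
        rw [h] at hdZ
        simp at hdZ
        omega
      calc _ ≤ (Y.map (algebraMap Fq Fe) - C b).roots.toFinset.card := by
            apply Finset.card_le_card
            intro x hx
            simp only [Finset.mem_filter, Finset.mem_univ, true_and] at hx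
            rw [Multiset.mem_toFinset, Polynomial.mem_roots hne]
            simp [IsRoot, eval_map_algebraMap, hx]
        _ ≤ _ := (Multiset.toFinset_card_le _)
        _ ≤ _ := Polynomial.card_roots' _
        _ = d := hdZ
  rw [Finset.card_univ, hFe] at hfib
  have hsum := aux_sum q (e / 2) hq1
  have hm : (q ^ (e / 2)) ^ 2 ≤ q ^ e := by
    rw [← pow_mul]
    exact Nat.pow_le_pow_right (by omega) (by omega)
  generalize q ^ (e / 2) = M at *
  have hN : S.card + 2 ≤ 2 * M := by omega
  generalize S.card = N at *
  have hQ : 0 < q ^ e := by positivity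
  generalize q ^ e = Q at *
  have h1 : Q ^ 2 ≤ (d * N) ^ 2 := Nat.pow_le_pow_left hfib 2
  have h2 : N ^ 2 < (2 * M) ^ 2 := Nat.pow_lt_pow_left (by omega) (by norm_num)
  have h3 : N ^ 2 < 4 * Q := by nlinarith
  have h4 : 4 * d ^ 2 * N ^ 2 ≤ Q * N ^ 2 := Nat.mul_le_mul_right _ hbig
  have h5 : Q * N ^ 2 < Q * (4 * Q) := Nat.mul_lt_mul_of_pos_left h3 hQ
  nlinarith
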